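/- arXiv:2302.07956 — 7 statements merged into one kernel-verified Lean document; each statement's English description precedes it below -/
import Mathlib

section
/- Let ε ≥ 0 and δ ∈ [0,1], and let P and Q be (ε,δ)-indistinguishable probability measures on a measurable space. Then every rejection rule φ, with type I error α = ∫ φ dP and type II error β = 1 − ∫ φ dQ, satisfies β ≥ max{0, 1 − δ − e^ε·α, e^{−ε}·(1 − δ − α)}. -/
open MeasureTheory Real

/-- An affine domination between two finite measures on measurable sets extends to integrals of
measurable `[0,1]`-valued functions. -/
theorem integral_le_mul_integral_add_of_forall_measurableSet {Ω : Type*} [MeasurableSpace Ω]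
    {c δ : ℝ} {μ ν : Measure Ω} [IsFiniteMeasure μ] [IsFiniteMeasure ν]
    (h : ∀ S : Set Ω, MeasurableSet S → μ.real S ≤ c * ν.real S + δ)
    {f : Ω → ℝ} (hf : Measurable f) (hf01 : ∀ x, f x ∈ Set.Icc (0 : ℝ) 1) :
    ∫ x, f x ∂μ ≤ c * ∫ x, f x ∂ν + δ := by
  have integrable_of (κ : Measure Ω) [IsFiniteMeasure κ] : Integrable f κ :=
    .of_mem_Icc 0 1 hf.aemeasurable (.of_forall hf01)
  have layer (κ : Measure Ω) [IsFiniteMeasure κ] :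
      ∫ x, f x ∂κ = ∫ t in Set.Ioc 0 1, κ.real {x | t ≤ f x} :=
    (integrable_of κ).integral_eq_integral_Ioc_meas_le (.of_forall fun x => (hf01 x).1)
      (.of_forall fun x => (hf01 x).2)
  have layer_int (κ : Measure Ω) [IsFiniteMeasure κ] :
      IntegrableOn (fun t => κ.real {x | t ≤ f x}) (Set.Ioc (0 : ℝ) 1) := by
    have anti : Antitone fun t => κ.real {x | t ≤ f x} := fun s t hst =>
      measureReal_mono fun x (hx : t ≤ f x) => hst.trans hx
    exact ((anti.antitoneOn _).integrableOn_isCompact isCompact_Icc).mono_set Set.Ioc_subset_Icc_self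
  calc ∫ x, f x ∂μ = ∫ t in Set.Ioc 0 1, μ.real {x | t ≤ f x} := layer μ
    _ ≤ ∫ t in Set.Ioc (0 : ℝ) 1, (c * ν.real {x | t ≤ f x} + δ) :=
        integral_mono (layer_int μ) (((layer_int ν).const_mul c).add (integrable_const δ))
          fun t => h _ (measurableSet_le measurable_const hf)
    _ = c * ∫ x, f x ∂ν + δ := by
        rw [integral_add ((layer_int ν).const_mul c) (integrable_const δ), integral_const_mul,
          ← layer ν]
        simp

/-- If `P` and `Q` are `(ε,δ)`-indistinguishable probability measures, then
every rejection rule `φ` with type I error `α = ∫ φ dP` and type II error `β = 1 - ∫ φ dQ`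
satisfies `β ≥ max {0, 1 - δ - e^ε α, e^{-ε} (1 - δ - α)}`. -/
theorem stmt_0 {Ω : Type*} [MeasurableSpace Ω]
    (ε δ : ℝ) (hε : 0 ≤ ε) (hδ : δ ∈ Set.Icc (0 : ℝ) 1)
    (P Q : Measure Ω) [IsProbabilityMeasure P] [IsProbabilityMeasure Q]
    (hPQ : ∀ S : Set Ω, MeasurableSet S → (P S).toReal ≤ exp ε * (Q S).toReal + δ)
    (hQP : ∀ S : Set Ω, MeasurableSet S → (Q S).toReal ≤ exp ε * (P S).toReal + δ)
    (φ : Ω → ℝ) (hφ : Measurable φ) (hφ01 : ∀ x, φ x ∈ Set.Icc (0 : ℝ) 1) :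
    1 - ∫ x, φ x ∂Q ≥
      max 0 (max (1 - δ - exp ε * ∫ x, φ x ∂P)
        (exp (-ε) * (1 - δ - ∫ x, φ x ∂P))) := by
  have integrable_of (κ : Measure Ω) [IsFiniteMeasure κ] : Integrable φ κ :=
    .of_mem_Icc 0 1 hφ.aemeasurable (.of_forall hφ01)
  have reject := integral_le_mul_integral_add_of_forall_measurableSet hQP hφ hφ01
  have accept := integral_le_mul_integral_add_of_forall_measurableSet hPQ
    (f := fun x => 1 - φ x) (hφ.const_sub 1)
    fun x => ⟨sub_nonneg.2 (hφ01 x).2, sub_le_self _ (hφ01 x).1⟩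
  have integral_one_sub (κ : Measure Ω) [IsProbabilityMeasure κ] :
      ∫ x, (1 - φ x) ∂κ = 1 - ∫ x, φ x ∂κ := by
    simp [integral_sub (integrable_const (1 : ℝ)) (integrable_of κ)]
  rw [integral_one_sub, integral_one_sub] at accept
  refine max_le ?_ (max_le (by linarith) ?_)
  · rw [← integral_one_sub]
    exact integral_nonneg fun x => sub_nonneg.2 (hφ01 x).2
  · rw [exp_neg, inv_mul_le_iff₀ (exp_pos ε)]
    linarith
end

section
/- Let ε ≥ 0 and δ ∈ [0,1], and let P and Q be probability measures on a measurable space such that every rejection rule φ, with type I error α = ∫ φ dP and type II error β = 1 − ∫ φ dQ, satisfies β ≥ max{0, 1 − δ − e^ε·α, e^{−ε}·(1 − δ − α)}. Then P and Q are (ε,δ)-indistinguishable, i.e., for every measurable set S, P(S) ≤ e^ε·Q(S) + δ and Q(S) ≤ e^ε·P(S) + δ. -/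
open MeasureTheory Real

/-- If every rejection rule `φ` against probability measures `P, Q` satisfies
`1 - ∫ φ dQ ≥ max {0, 1 - δ - e^ε ∫ φ dP, e^{-ε} (1 - δ - ∫ φ dP)}`, then `P` and `Q` are
`(ε,δ)`-indistinguishable. -/
theorem stmt_1 {Ω : Type*} [MeasurableSpace Ω]
    (ε δ : ℝ) (hε : 0 ≤ ε) (hδ : δ ∈ Set.Icc (0 : ℝ) 1)
    (P Q : Measure Ω) [IsProbabilityMeasure P] [IsProbabilityMeasure Q]
    (h : ∀ φ : Ω → ℝ, Measurable φ → (∀ x, φ x ∈ Set.Icc (0 : ℝ) 1) →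
      1 - ∫ x, φ x ∂Q ≥
        max 0 (max (1 - δ - exp ε * ∫ x, φ x ∂P)
          (exp (-ε) * (1 - δ - ∫ x, φ x ∂P)))) :
    ∀ S : Set Ω, MeasurableSet S →
      (P S).toReal ≤ exp ε * (Q S).toReal + δ ∧
      (Q S).toReal ≤ exp ε * (P S).toReal + δ := by
  have key : ∀ T : Set Ω, MeasurableSet T →
      1 - δ - exp ε * P.real T ≤ 1 - Q.real T ∧
      exp (-ε) * (1 - δ - P.real T) ≤ 1 - Q.real T := by
    intro T hT
    have hφ := h (T.indicator 1) (measurable_one.indicator hT) fun x =>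
      ⟨Set.indicator_nonneg (fun _ _ => zero_le_one) x,
        Set.indicator_le_self' (fun _ _ => zero_le_one) x⟩
    rw [integral_indicator_one hT, integral_indicator_one hT] at hφ
    exact max_le_iff.1 (max_le_iff.1 hφ).2
  intro S hS
  change P.real S ≤ exp ε * Q.real S + δ ∧ Q.real S ≤ exp ε * P.real S + δ
  constructor
  · have hc := (key Sᶜ hS.compl).2
    rw [probReal_compl_eq_one_sub hS, probReal_compl_eq_one_sub hS, exp_neg,
      inv_mul_le_iff₀ (exp_pos ε), sub_sub_cancel] at hc
    linarith
  · linarith [(key S hS).1]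
end

section
/- Let ε ≥ 0 and δ ∈ [0,1], and let P and Q be (ε,δ)-indistinguishable probability measures on a measurable space. Then for every rejection rule φ, with type I error α = ∫ φ dP and type II error β = 1 − ∫ φ dQ, the pair (α, β) lies in the privacy region: α + e^ε·β ≥ 1 − δ, e^ε·α + β ≥ 1 − δ, α + e^ε·β ≤ e^ε + δ, and e^ε·α + β ≤ e^ε + δ. -/
open MeasureTheory Real

/-- If `μ S ≤ c * ν S + δ` for all measurable sets `S`, then the same inequality holds for the
integrals of any measurable `[0,1]`-valued function. -/
theorem integral_le_mul_integral_add_of_forall_measure_le {Ω : Type*} [MeasurableSpace Ω]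
    {c δ : ℝ} {μ ν : Measure Ω} [IsFiniteMeasure μ] [IsFiniteMeasure ν]
    (h : ∀ S : Set Ω, MeasurableSet S → (μ S).toReal ≤ c * (ν S).toReal + δ)
    {f : Ω → ℝ} (hf : Measurable f) (hf01 : ∀ x, f x ∈ Set.Icc (0 : ℝ) 1) :
    ∫ x, f x ∂μ ≤ c * ∫ x, f x ∂ν + δ := by
  have layercake : ∀ (ρ : Measure Ω) [IsFiniteMeasure ρ],
      ∫ x, f x ∂ρ = ∫ t in Set.Ioc (0 : ℝ) 1, ρ.real {x | t ≤ f x} := fun ρ _ =>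
    (Integrable.of_mem_Icc 0 1 hf.aemeasurable (ae_of_all _ hf01)).integral_eq_integral_Ioc_meas_le
      (ae_of_all _ fun x => (hf01 x).1) (ae_of_all _ fun x => (hf01 x).2)
  have integrable_tail : ∀ (ρ : Measure Ω) [IsFiniteMeasure ρ],
      IntegrableOn (fun t => ρ.real {x | t ≤ f x}) (Set.Ioc (0 : ℝ) 1) := fun ρ _ =>
    (AntitoneOn.integrableOn_isCompact isCompact_Icc fun s _ t _ hst =>
      measureReal_mono fun x (hx : t ≤ f x) => hst.trans hx).mono_set Set.Ioc_subset_Icc_self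
  calc ∫ x, f x ∂μ
      = ∫ t in Set.Ioc (0 : ℝ) 1, μ.real {x | t ≤ f x} := layercake μ
    _ ≤ ∫ t in Set.Ioc (0 : ℝ) 1, (c * ν.real {x | t ≤ f x} + δ) :=
        integral_mono (integrable_tail μ)
          (((integrable_tail ν).const_mul c).add (integrable_const δ))
          fun t => h _ (measurableSet_le measurable_const hf)
    _ = c * ∫ x, f x ∂ν + δ := by
        rw [integral_add ((integrable_tail ν).const_mul c) (integrable_const δ),
          integral_const_mul, ← layercake ν]
        simp

/-- If `P` and `Q` are `(ε,δ)`-indistinguishable probability measures, then the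
type I and type II errors `(α, β)` of any rejection rule lie in the privacy region of
Kairouz et al.: `α + e^ε β ≥ 1 - δ`, `e^ε α + β ≥ 1 - δ`, `α + e^ε β ≤ e^ε + δ`, and
`e^ε α + β ≤ e^ε + δ`. -/
theorem stmt_2 {Ω : Type*} [MeasurableSpace Ω]
    (ε δ : ℝ) (hε : 0 ≤ ε) (hδ : δ ∈ Set.Icc (0 : ℝ) 1)
    (P Q : Measure Ω) [IsProbabilityMeasure P] [IsProbabilityMeasure Q]
    (hPQ : ∀ S : Set Ω, MeasurableSet S → (P S).toReal ≤ exp ε * (Q S).toReal + δ)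
    (hQP : ∀ S : Set Ω, MeasurableSet S → (Q S).toReal ≤ exp ε * (P S).toReal + δ)
    (φ : Ω → ℝ) (hφ : Measurable φ) (hφ01 : ∀ x, φ x ∈ Set.Icc (0 : ℝ) 1)
    (α β : ℝ) (hα : α = ∫ x, φ x ∂P) (hβ : β = 1 - ∫ x, φ x ∂Q) :
    α + exp ε * β ≥ 1 - δ ∧
    exp ε * α + β ≥ 1 - δ ∧
    α + exp ε * β ≤ exp ε + δ ∧
    exp ε * α + β ≤ exp ε + δ := by
  have hφ' : Measurable fun x => 1 - φ x := measurable_const.sub hφ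
  have hφ01' : ∀ x, 1 - φ x ∈ Set.Icc (0 : ℝ) 1 := fun x =>
    ⟨sub_nonneg.2 (hφ01 x).2, sub_le_self _ (hφ01 x).1⟩
  have integral_one_sub : ∀ (ρ : Measure Ω) [IsProbabilityMeasure ρ],
      ∫ x, (1 - φ x) ∂ρ = 1 - ∫ x, φ x ∂ρ := fun ρ _ => by
    rw [integral_sub (integrable_const 1)
      (Integrable.of_mem_Icc 0 1 hφ.aemeasurable (ae_of_all _ hφ01))]
    simp
  have h₁ := integral_le_mul_integral_add_of_forall_measure_le hPQ hφ hφ01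
  have h₂ := integral_le_mul_integral_add_of_forall_measure_le hQP hφ hφ01
  have h₃ := integral_le_mul_integral_add_of_forall_measure_le hPQ hφ' hφ01'
  have h₄ := integral_le_mul_integral_add_of_forall_measure_le hQP hφ' hφ01'
  rw [integral_one_sub P, integral_one_sub Q] at h₃ h₄
  subst hα hβ
  refine ⟨?_, ?_, ?_, ?_⟩ <;> linarith
end

section
/- Let ε ≥ 0 and δ ∈ [0,1], let P and Q be (ε,δ)-indistinguishable probability measures on a measurable space, and let φ be a rejection rule with type I error α = ∫ φ dP and type II error β = 1 − ∫ φ dQ. If β > 0 and 1 − δ − α > 0, then ε ≥ ln((1 − δ − α)/β); and if α > 0 and 1 − δ − β > 0, then ε ≥ ln((1 − δ − β)/α). -/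
open MeasureTheory Real

/-- Indistinguishability on measurable sets extends to `[0, 1]`-valued measurable functions. -/
theorem integral_le_mul_integral_add_of_measure_le {Ω : Type*} [MeasurableSpace Ω]
    {c δ : ℝ} {P Q : Measure Ω} [IsFiniteMeasure P] [IsFiniteMeasure Q]
    (h : ∀ S : Set Ω, MeasurableSet S → P.real S ≤ c * Q.real S + δ)
    {f : Ω → ℝ} (hf : Measurable f) (hf01 : ∀ x, f x ∈ Set.Icc (0 : ℝ) 1) :
    ∫ x, f x ∂P ≤ c * ∫ x, f x ∂Q + δ := by
  have layercake (μ : Measure Ω) [IsFiniteMeasure μ] :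
      ∫ x, f x ∂μ = ∫ t in Set.Ioc (0 : ℝ) 1, μ.real {x | t ≤ f x} :=
    (Integrable.of_mem_Icc 0 1 hf.aemeasurable
      (ae_of_all _ hf01)).integral_eq_integral_Ioc_meas_le
      (ae_of_all _ fun x => (hf01 x).1) (ae_of_all _ fun x => (hf01 x).2)
  have integrable_tail (μ : Measure Ω) [IsFiniteMeasure μ] :
      IntegrableOn (fun t : ℝ => μ.real {x | t ≤ f x}) (Set.Ioc 0 1) := by
    have anti : Antitone fun t : ℝ => μ.real {x | t ≤ f x} :=
      fun s t hst => measureReal_mono fun x hx => le_trans hst hx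
    exact ((anti.antitoneOn _).integrableOn_isCompact isCompact_Icc).mono_set
      Set.Ioc_subset_Icc_self
  calc ∫ x, f x ∂P
      = ∫ t in Set.Ioc (0 : ℝ) 1, P.real {x | t ≤ f x} := layercake P
    _ ≤ ∫ t in Set.Ioc (0 : ℝ) 1, (c * Q.real {x | t ≤ f x} + δ) :=
        integral_mono (integrable_tail P)
          (((integrable_tail Q).const_mul c).add (integrable_const δ))
          fun t => h _ (measurableSet_le measurable_const hf)
    _ = c * ∫ x, f x ∂Q + δ := by
        rw [integral_add ((integrable_tail Q).const_mul c) (integrable_const δ),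
          integral_const_mul, ← layercake Q]
        simp

/-- If `P` and `Q` are `(ε,δ)`-indistinguishable probability measures and `φ` is
a rejection rule with type I error `α` and type II error `β`, then (whenever the logarithms'
arguments are positive) `ε ≥ ln((1 - δ - α)/β)` and `ε ≥ ln((1 - δ - β)/α)`. -/
theorem stmt_3 {Ω : Type*} [MeasurableSpace Ω]
    (ε δ : ℝ) (hε : 0 ≤ ε) (hδ : δ ∈ Set.Icc (0 : ℝ) 1)
    (P Q : Measure Ω) [IsProbabilityMeasure P] [IsProbabilityMeasure Q]
    (hPQ : ∀ S : Set Ω, MeasurableSet S → (P S).toReal ≤ exp ε * (Q S).toReal + δ)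
    (hQP : ∀ S : Set Ω, MeasurableSet S → (Q S).toReal ≤ exp ε * (P S).toReal + δ)
    (φ : Ω → ℝ) (hφ : Measurable φ) (hφ01 : ∀ x, φ x ∈ Set.Icc (0 : ℝ) 1)
    (α β : ℝ) (hα : α = ∫ x, φ x ∂P) (hβ : β = 1 - ∫ x, φ x ∂Q) :
    (0 < β → 0 < 1 - δ - α → ε ≥ Real.log ((1 - δ - α) / β)) ∧
    (0 < α → 0 < 1 - δ - β → ε ≥ Real.log ((1 - δ - β) / α)) := by
  have log_le {a b : ℝ} (hb : 0 < b) (ha : 0 < a) (hab : a ≤ exp ε * b) :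
      ε ≥ Real.log (a / b) :=
    (Real.log_le_iff_le_exp (div_pos ha hb)).2 ((div_le_iff₀ hb).2 hab)
  have integral_one_sub (μ : Measure Ω) [IsProbabilityMeasure μ] :
      ∫ x, (1 - φ x) ∂μ = 1 - ∫ x, φ x ∂μ := by
    rw [integral_sub (integrable_const 1)
      (Integrable.of_mem_Icc 0 1 hφ.aemeasurable (ae_of_all _ hφ01))]
    simp
  have hP := integral_le_mul_integral_add_of_measure_le hPQ (hφ.const_sub 1)
    fun x => ⟨sub_nonneg.2 (hφ01 x).2, sub_le_self 1 (hφ01 x).1⟩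
  rw [integral_one_sub, integral_one_sub, ← hα, ← hβ] at hP
  have hQ := integral_le_mul_integral_add_of_measure_le hQP hφ hφ01
  rw [← hα] at hQ
  exact ⟨fun hb ha => log_le hb ha (by linarith), fun hb ha => log_le hb ha (by linarith)⟩
end

section
/- Let σ > 0, m ∈ ℝ, c ∈ ℝ, and let P = N(m, σ²) and Q = N(m + c, σ²) be Gaussian probability measures on ℝ. Then every rejection rule φ with type I error α = ∫ φ dP satisfying α ∈ (0,1) has type II error β = 1 − ∫ φ dQ satisfying β ≥ Φ(Φ⁻¹(1 − α) − |c|/σ); that is, the pair (P, Q) satisfies (|c|/σ)-Gaussian differential privacy. -/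
open MeasureTheory ProbabilityTheory Real

/-- The standard normal cumulative distribution function `Φ`. -/
noncomputable def Phi (x : ℝ) : ℝ := ((gaussianReal 0 1) (Set.Iic x)).toReal

/-- The inverse `Φ⁻¹` of the standard normal CDF (on `(0,1)`). -/
noncomputable def PhiInv : ℝ → ℝ := Function.invFun Phi

lemma Phi_eq_cdf : Phi = cdf (gaussianReal 0 1) := by
  ext x
  rw [cdf_eq_real]
  rfl

lemma continuous_Phi : Continuous Phi := by
  have := nullSingletonClass_gaussianReal (μ := 0) (one_ne_zero : (1 : NNReal) ≠ 0)
  have h : Phi = fun b ↦ ∫ _ in Set.Iic b, (1 : ℝ) ∂(gaussianReal 0 1) := by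
    ext b
    simp [Phi, Measure.real]
  rw [h, continuous_iff_continuousAt]
  intro x
  exact ((integrable_const (1 : ℝ)).integrableOn.continuousOn_Iic_primitive_Iic
    (a₀ := x + 1)).continuousAt (Iic_mem_nhds (by linarith))

lemma Phi_PhiInv {p : ℝ} (hp : p ∈ Set.Ioo (0 : ℝ) 1) : Phi (PhiInv p) = p := by
  have hbot := (tendsto_cdf_atBot (gaussianReal 0 1)).eventually_lt_const hp.1
  have htop := (tendsto_cdf_atTop (gaussianReal 0 1)).eventually_const_lt hp.2
  rw [← Phi_eq_cdf] at hbot htop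
  exact Function.invFun_eq (mem_range_of_exists_le_of_exists_ge continuous_Phi
    (hbot.exists.imp fun _ ↦ le_of_lt) (htop.exists.imp fun _ ↦ le_of_lt))

lemma Phi_sub (t μ : ℝ) : Phi (t - μ) = (gaussianReal μ 1).real (Set.Iic t) := by
  have h := gaussianReal_map_add_const (μ := 0) (v := 1) μ
  rw [zero_add] at h
  rw [← h, map_measureReal_apply (by fun_prop) measurableSet_Iic]
  simp [Phi, Measure.real]

lemma gaussianPDFReal_eq_exp_mul (μ x : ℝ) :
    gaussianPDFReal μ 1 x = rexp (μ * x - μ ^ 2 / 2) * gaussianPDFReal 0 1 x := by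
  simp only [gaussianPDFReal, NNReal.coe_one]
  rw [mul_left_comm, ← Real.exp_add]
  ring_nf

/-- The Neyman–Pearson inequality for shifted unit-variance Gaussians. -/
lemma le_integral_gaussianReal_of_threshold {μ t : ℝ} (hμ : 0 ≤ μ) {g : ℝ → ℝ}
    (hg : Measurable g) (hg_bdd : ∀ x, |g x| ≤ 1)
    (hg_le : ∀ x ≤ t, g x ≤ 0) (hg_ge : ∀ x, t < x → 0 ≤ g x) :
    rexp (μ * t - μ ^ 2 / 2) * ∫ x, g x ∂(gaussianReal 0 1) ≤ ∫ x, g x ∂(gaussianReal μ 1) := by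
  have hint (ν : ℝ) : Integrable (fun x ↦ gaussianPDFReal ν 1 x • g x) volume :=
    (integrable_gaussianPDFReal ν 1).mul_bdd hg.aestronglyMeasurable (ae_of_all _ hg_bdd)
  rw [integral_gaussianReal_eq_integral_smul one_ne_zero,
    integral_gaussianReal_eq_integral_smul one_ne_zero, ← integral_const_mul]
  refine integral_mono ((hint 0).const_mul _) (hint μ) fun x ↦ ?_
  simp only [smul_eq_mul]
  rw [gaussianPDFReal_eq_exp_mul μ x, ← mul_assoc, mul_right_comm, mul_right_comm _ _ (g x)]
  refine mul_le_mul_of_nonneg_right ?_ (gaussianPDFReal_nonneg 0 1 x)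
  rcases le_or_gt x t with h | h
  · exact mul_le_mul_of_nonpos_right (exp_le_exp.2 (by gcongr)) (hg_le x h)
  · exact mul_le_mul_of_nonneg_right (exp_le_exp.2 (by gcongr)) (hg_ge x h)

lemma Phi_sub_le_typeII {μ t : ℝ} (hμ : 0 ≤ μ) {ψ : ℝ → ℝ} (hψ : Measurable ψ)
    (hψ01 : ∀ x, ψ x ∈ Set.Icc (0 : ℝ) 1) (ht : Phi t = 1 - ∫ x, ψ x ∂(gaussianReal 0 1)) :
    Phi (t - μ) ≤ 1 - ∫ x, ψ x ∂(gaussianReal μ 1) := by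
  have hint (ν : ℝ) : ∫ x, (1 - ψ x - (Set.Iic t).indicator 1 x) ∂(gaussianReal ν 1)
      = 1 - ∫ x, ψ x ∂(gaussianReal ν 1) - (gaussianReal ν 1).real (Set.Iic t) := by
    have hψi : Integrable ψ (gaussianReal ν 1) :=
      Integrable.of_bound hψ.aestronglyMeasurable 1
        (ae_of_all _ fun x ↦ by rw [norm_eq_abs, abs_of_nonneg (hψ01 x).1]; exact (hψ01 x).2)
    have hind : Integrable ((Set.Iic t).indicator (1 : ℝ → ℝ)) (gaussianReal ν 1) :=
      (integrable_const (1 : ℝ)).indicator measurableSet_Iic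
    have hsub : Integrable (fun x ↦ 1 - ψ x) (gaussianReal ν 1) := (integrable_const 1).sub hψi
    rw [integral_sub hsub hind, integral_sub (integrable_const _) hψi, integral_indicator_one measurableSet_Iic]
    simp
  have h := le_integral_gaussianReal_of_threshold hμ (t := t)
    (g := fun x ↦ 1 - ψ x - (Set.Iic t).indicator 1 x)
    ((measurable_const.sub hψ).sub (measurable_one.indicator measurableSet_Iic))
    (fun x ↦ by
      have := hψ01 x
      by_cases hx : x ≤ t <;> simp [hx, abs_le] <;> constructor <;> linarith [this.1, this.2])
    (fun x hx ↦ by simpa [hx] using (hψ01 x).1)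
    (fun x hx ↦ by simpa [hx] using (hψ01 x).2)
  rw [hint, hint, ← ht, ← Phi_sub t μ, ← sub_zero t, ← Phi_sub] at h
  simpa using h

lemma integral_gaussianReal_eq_integral_affine {a b ν : ℝ} {v : NNReal} (hv : (v : ℝ) = a ^ 2)
    {φ : ℝ → ℝ} (hφ : Measurable φ) :
    ∫ x, φ x ∂(gaussianReal (b + a * ν) v) = ∫ z, φ (b + a * z) ∂(gaussianReal ν 1) := by
  have h : (gaussianReal ν 1).map (fun z ↦ b + a * z) = gaussianReal (b + a * ν) v := by
    have := gaussianReal_map_const_mul (μ := ν) (v := 1) a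
    rw [← Function.comp_def (b + ·) (a * ·), ← Measure.map_map (by fun_prop) (by fun_prop), this,
      gaussianReal_map_const_add, add_comm]
    congr 1
    ext
    simp [hv]
  rw [← h, integral_map (by fun_prop) hφ.aestronglyMeasurable]

/-- For the Gaussian measures `P = N(m, σ²)` and `Q = N(m + c, σ²)`, every
rejection rule with type I error `α ∈ (0,1)` has type II error at least
`Φ(Φ⁻¹(1 - α) - |c|/σ)`; i.e. `(P, Q)` satisfies `(|c|/σ)`-Gaussian differential privacy. -/
theorem stmt_4 (σ m c : ℝ) (hσ : 0 < σ)
    (φ : ℝ → ℝ) (hφ : Measurable φ) (hφ01 : ∀ x, φ x ∈ Set.Icc (0 : ℝ) 1)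
    (hα : (∫ x, φ x ∂(gaussianReal m ⟨σ ^ 2, sq_nonneg σ⟩)) ∈ Set.Ioo (0 : ℝ) 1) :
    1 - ∫ x, φ x ∂(gaussianReal (m + c) ⟨σ ^ 2, sq_nonneg σ⟩) ≥
      Phi (PhiInv (1 - ∫ x, φ x ∂(gaussianReal m ⟨σ ^ 2, sq_nonneg σ⟩)) - |c| / σ) := by
  obtain ⟨a, ha, hac⟩ : ∃ a : ℝ, a ^ 2 = σ ^ 2 ∧ a * (|c| / σ) = c := by
    rcases abs_cases c with ⟨h, -⟩ | ⟨h, -⟩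
    · exact ⟨σ, rfl, by rw [h]; field_simp⟩
    · exact ⟨-σ, by ring, by rw [h]; field_simp⟩
  have hP := integral_gaussianReal_eq_integral_affine (b := m) (ν := 0)
    (v := ⟨σ ^ 2, sq_nonneg σ⟩) ha.symm hφ
  have hQ := integral_gaussianReal_eq_integral_affine (b := m) (ν := |c| / σ)
    (v := ⟨σ ^ 2, sq_nonneg σ⟩) ha.symm hφ
  rw [mul_zero, add_zero] at hP
  rw [hac] at hQ
  rw [hP] at hα ⊢
  rw [hQ]
  exact Phi_sub_le_typeII (by positivity) (hφ.comp (by fun_prop)) (fun _ ↦ hφ01 _)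
    (Phi_PhiInv ⟨by linarith [hα.2], by linarith [hα.1]⟩)
end

section
/- Let σ > 0, c > 0, set μ = c/σ, and let P = N(0, σ²) and Q = N(c, σ²) be Gaussian probability measures on ℝ. Then for every ε ≥ 0, P and Q are (ε, δ_μ(ε))-indistinguishable, where δ_μ(ε) = Φ(−ε/μ + μ/2) − e^ε·Φ(−ε/μ − μ/2): for every measurable set S ⊆ ℝ, P(S) ≤ e^ε·Q(S) + δ_μ(ε) and Q(S) ≤ e^ε·P(S) + δ_μ(ε). -/
open MeasureTheory ProbabilityTheory Real

/-- Neyman–Pearson inequality: the integral of `h` over a set is maximal over the set where `h` is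
nonnegative. -/
theorem setIntegral_le_setIntegral_of_sign {α : Type*} [MeasurableSpace α] {ν : Measure α}
    {h : α → ℝ} (hh : Integrable h ν) {S A : Set α} (hS : MeasurableSet S) (hA : MeasurableSet A)
    (hpos : ∀ x ∈ A, 0 ≤ h x) (hneg : ∀ x ∉ A, h x ≤ 0) :
    ∫ x in S, h x ∂ν ≤ ∫ x in A, h x ∂ν := by
  rw [← integral_indicator hS, ← integral_indicator hA]
  refine integral_mono (hh.indicator hS) (hh.indicator hA) fun x => ?_
  by_cases hxA : x ∈ A
  · by_cases hxS : x ∈ S <;> simp [hxA, hxS, hpos x hxA]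
  · by_cases hxS : x ∈ S <;> simp [hxA, hxS, hneg x hxA]

theorem toReal_gaussianReal_apply (m : ℝ) (S : Set ℝ) :
    (gaussianReal m 1 S).toReal = ∫ x in S, gaussianPDFReal m 1 x := by
  rw [gaussianReal_apply_eq_integral m one_ne_zero, ENNReal.toReal_ofReal]
  exact integral_nonneg fun x => gaussianPDFReal_nonneg m 1 x

theorem toReal_gaussianReal_Iic (m t : ℝ) :
    (gaussianReal m 1 (Set.Iic t)).toReal = Phi (t - m) := by
  have h := gaussianReal_map_add_const (μ := 0) (v := 1) m
  rw [zero_add] at h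
  rw [Phi, ← h, Measure.map_apply (measurable_add_const m) measurableSet_Iic]
  congr 2
  ext x
  simp [le_sub_iff_add_le]

theorem exp_mul_gaussianPDFReal_le_iff {μ : ℝ} (hμ : 0 < μ) (ε x : ℝ) :
    exp ε * gaussianPDFReal μ 1 x ≤ gaussianPDFReal 0 1 x ↔ x ≤ -ε / μ + μ / 2 := by
  have hc : (0 : ℝ) < (√(2 * π * (1 : NNReal)))⁻¹ := by
    simp only [NNReal.coe_one]; positivity
  rw [gaussianPDFReal, gaussianPDFReal, mul_left_comm, mul_le_mul_iff_right₀ hc, ← exp_add,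
    exp_le_exp]
  have : -ε / μ + μ / 2 = (-ε + μ ^ 2 / 2) / μ := by field_simp
  rw [this, le_div_iff₀ hμ]
  simp only [NNReal.coe_one]
  constructor <;> intro h <;> nlinarith

/-- The first inequality for the unit-variance pair `N(0, 1)`, `N(μ, 1)`. -/
theorem gaussianReal_zero_one_le {μ : ℝ} (hμ : 0 < μ) (ε : ℝ) {S : Set ℝ} (hS : MeasurableSet S) :
    (gaussianReal 0 1 S).toReal ≤ exp ε * (gaussianReal μ 1 S).toReal +
      (Phi (-ε / μ + μ / 2) - exp ε * Phi (-ε / μ - μ / 2)) := by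
  set t := -ε / μ + μ / 2 with ht
  have hP := toReal_gaussianReal_Iic 0 t
  have hQ := toReal_gaussianReal_Iic μ t
  rw [sub_zero] at hP
  rw [show t - μ = -ε / μ - μ / 2 by rw [ht]; ring] at hQ
  rw [← hP, ← hQ]
  simp only [toReal_gaussianReal_apply]
  have hi := integrable_gaussianPDFReal 0 1
  have hj := (integrable_gaussianPDFReal μ 1).const_mul (exp ε)
  have key := setIntegral_le_setIntegral_of_sign (hi.sub hj) hS (measurableSet_Iic (a := t))
    (fun x hx => sub_nonneg.2 ((exp_mul_gaussianPDFReal_le_iff hμ ε x).2 hx))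
    (fun x hx => sub_nonpos.2
      (le_of_not_ge fun h => hx ((exp_mul_gaussianPDFReal_le_iff hμ ε x).1 h)))
  simp only [Pi.sub_apply] at key
  rw [integral_sub hi.integrableOn hj.integrableOn, integral_sub hi.integrableOn hj.integrableOn,
    integral_const_mul, integral_const_mul] at key
  linarith

/-- The second inequality for the unit-variance pair, by the reflection `x ↦ μ - x`. -/
theorem gaussianReal_shift_one_le {μ : ℝ} (hμ : 0 < μ) (ε : ℝ) {S : Set ℝ}
    (hS : MeasurableSet S) :
    (gaussianReal μ 1 S).toReal ≤ exp ε * (gaussianReal 0 1 S).toReal +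
      (Phi (-ε / μ + μ / 2) - exp ε * Phi (-ε / μ - μ / 2)) := by
  have hm : Measurable fun x : ℝ => μ - x := measurable_const_sub μ
  have h := gaussianReal_zero_one_le hμ ε (hm hS)
  have h0 := gaussianReal_map_const_sub (μ := 0) (v := 1) μ
  have h1 := gaussianReal_map_const_sub (μ := μ) (v := 1) μ
  rw [sub_zero] at h0
  rw [sub_self] at h1
  rwa [← Measure.map_apply hm hS, ← Measure.map_apply hm hS, h0, h1] at h

theorem gaussianReal_sq_apply (σ m : ℝ) {S : Set ℝ} (hS : MeasurableSet S) :
    gaussianReal (σ * m) ⟨σ ^ 2, sq_nonneg σ⟩ S = gaussianReal m 1 ((fun x => σ * x) ⁻¹' S) := by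
  rw [← Measure.map_apply (measurable_const_mul σ) hS, gaussianReal_map_const_mul, mul_one]
  rfl

/-- For `μ = c/σ`, the Gaussian measures `P = N(0, σ²)` and `Q = N(c, σ²)` are
`(ε, δ_μ(ε))`-indistinguishable for every `ε ≥ 0`, where
`δ_μ(ε) = Φ(-ε/μ + μ/2) - e^ε Φ(-ε/μ - μ/2)`. -/
theorem stmt_7 (σ c : ℝ) (hσ : 0 < σ) (hc : 0 < c) (μ : ℝ) (hμ : μ = c / σ)
    (ε : ℝ) (hε : 0 ≤ ε) :
    ∀ S : Set ℝ, MeasurableSet S →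
      ((gaussianReal 0 ⟨σ ^ 2, sq_nonneg σ⟩) S).toReal ≤
        exp ε * ((gaussianReal c ⟨σ ^ 2, sq_nonneg σ⟩) S).toReal +
          (Phi (-ε / μ + μ / 2) - exp ε * Phi (-ε / μ - μ / 2)) ∧
      ((gaussianReal c ⟨σ ^ 2, sq_nonneg σ⟩) S).toReal ≤
        exp ε * ((gaussianReal 0 ⟨σ ^ 2, sq_nonneg σ⟩) S).toReal +
          (Phi (-ε / μ + μ / 2) - exp ε * Phi (-ε / μ - μ / 2)) := by
  intro S hS
  have hμ0 : 0 < μ := hμ ▸ div_pos hc hσ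
  have hcσ : c = σ * μ := by rw [hμ]; field_simp
  have hS' : MeasurableSet ((fun x => σ * x) ⁻¹' S) := measurable_const_mul σ hS
  have hP := gaussianReal_sq_apply σ 0 hS
  rw [mul_zero] at hP
  rw [hP, hcσ, gaussianReal_sq_apply σ μ hS]
  exact ⟨gaussianReal_zero_one_le hμ0 ε hS', gaussianReal_shift_one_le hμ0 ε hS'⟩
end

section
/- Let σ > 0, c > 0, δ ∈ ℝ, and define h : ℝ → ℝ by h(z) = (1 − δ − Φ((z − c)/σ))/(1 − Φ(z/σ)). Then h is differentiable on ℝ and, for any z ∈ ℝ, h'(z) = 0 if and only if δ = Φ((c − z)/σ) − (φ_pdf((c − z)/σ)/φ_pdf(z/σ))·Φ(−z/σ). -/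
open MeasureTheory ProbabilityTheory Real

/-- The standard normal density `φ_pdf(x) = exp(-x²/2)/√(2π)`. -/
noncomputable def phiPdf (x : ℝ) : ℝ := Real.exp (-x ^ 2 / 2) / Real.sqrt (2 * Real.pi)

lemma phiPdf_pos (x : ℝ) : 0 < phiPdf x := by
  unfold phiPdf
  positivity

lemma phiPdf_neg (x : ℝ) : phiPdf (-x) = phiPdf x := by
  simp [phiPdf]

lemma continuous_phiPdf : Continuous phiPdf := by
  unfold phiPdf
  fun_prop

lemma phiPdf_eq_gaussianPDFReal : phiPdf = gaussianPDFReal 0 1 := by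
  ext x
  simp [phiPdf, gaussianPDFReal, div_eq_inv_mul]

lemma integrable_phiPdf : Integrable phiPdf := by
  rw [phiPdf_eq_gaussianPDFReal]
  exact integrable_gaussianPDFReal 0 1

lemma Phi_eq_integral (x : ℝ) : Phi x = ∫ t in Set.Iic x, phiPdf t := by
  rw [Phi, gaussianReal_apply_eq_integral 0 one_ne_zero, ENNReal.toReal_ofReal,
    phiPdf_eq_gaussianPDFReal]
  exact integral_nonneg fun t => gaussianPDFReal_nonneg 0 1 t

lemma Phi_eq_add_intervalIntegral (x : ℝ) : Phi x = Phi 0 + ∫ t in (0 : ℝ)..x, phiPdf t := by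
  rw [Phi_eq_integral, Phi_eq_integral, ← intervalIntegral.integral_Iic_sub_Iic
    integrable_phiPdf.integrableOn integrable_phiPdf.integrableOn]
  ring

lemma hasDerivAt_Phi (x : ℝ) : HasDerivAt Phi (phiPdf x) x := by
  rw [funext Phi_eq_add_intervalIntegral]
  exact (continuous_phiPdf.integral_hasStrictDerivAt 0 x).hasDerivAt.const_add _

lemma Phi_pos (x : ℝ) : 0 < Phi x := by
  refine ENNReal.toReal_pos (fun h => ?_) (measure_ne_top _ _)
  have := gaussianReal_absolutelyContinuous' 0 one_ne_zero h
  simp at this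

lemma one_sub_Phi (x : ℝ) : 1 - Phi x = Phi (-x) := by
  have := nullSingletonClass_gaussianReal (μ := 0) one_ne_zero
  have hneg : gaussianReal 0 1 (Set.Iic (-x)) = gaussianReal 0 1 (Set.Ioi x) := by
    conv_lhs => rw [← neg_zero, ← gaussianReal_map_neg]
    rw [Measure.map_apply measurable_neg measurableSet_Iic, ← measure_congr Ioi_ae_eq_Ici.symm]
    congr 1
    ext t
    simp
  have hcompl := probReal_compl_eq_one_sub (μ := gaussianReal 0 1) (measurableSet_Iic (a := x))
  rw [Set.compl_Iic] at hcompl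
  rw [Phi, Phi, hneg]
  exact hcompl.symm

lemma hasDerivAt_one_sub_Phi_ratio {σ : ℝ} (c δ z : ℝ) :
    HasDerivAt (fun z : ℝ => (1 - δ - Phi ((z - c) / σ)) / (1 - Phi (z / σ)))
      (((Phi ((c - z) / σ) - δ) * phiPdf (z / σ) - phiPdf ((c - z) / σ) * Phi (-z / σ)) /
        (σ * Phi (-z / σ) ^ 2)) z := by
  have hnum : HasDerivAt (fun z : ℝ => 1 - δ - Phi ((z - c) / σ))
      (-(phiPdf ((z - c) / σ) * (1 / σ))) z :=
    ((hasDerivAt_Phi _).comp z (((hasDerivAt_id z).sub_const c).div_const σ)).const_sub _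
  have hden : HasDerivAt (fun z : ℝ => 1 - Phi (z / σ)) (-(phiPdf (z / σ) * (1 / σ))) z :=
    ((hasDerivAt_Phi _).comp z ((hasDerivAt_id z).div_const σ)).const_sub _
  have hz : 1 - Phi (z / σ) = Phi (-z / σ) := by rw [one_sub_Phi, neg_div]
  have hzc : 1 - δ - Phi ((z - c) / σ) = Phi ((c - z) / σ) - δ := by
    rw [sub_right_comm, one_sub_Phi, ← neg_div, neg_sub]
  have hpdf : phiPdf ((z - c) / σ) = phiPdf ((c - z) / σ) := by
    rw [← phiPdf_neg, ← neg_div, neg_sub]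
  refine (hnum.div hden (hz ▸ (Phi_pos _).ne')).congr_deriv ?_
  rw [hz, hzc, hpdf, div_mul_eq_div_div]
  ring

/-- The function `h(z) = (1 - δ - Φ((z - c)/σ))/(1 - Φ(z/σ))` is
differentiable on `ℝ`, and `h'(z) = 0` iff
`δ = Φ((c - z)/σ) - (φ_pdf((c - z)/σ)/φ_pdf(z/σ)) Φ(-z/σ)`. -/
theorem stmt_13 (σ c δ : ℝ) (hσ : 0 < σ) (hc : 0 < c) :
    (∀ z : ℝ, DifferentiableAt ℝ
      (fun z : ℝ => (1 - δ - Phi ((z - c) / σ)) / (1 - Phi (z / σ))) z) ∧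
    (∀ z : ℝ,
      deriv (fun z : ℝ => (1 - δ - Phi ((z - c) / σ)) / (1 - Phi (z / σ))) z = 0 ↔
      δ = Phi ((c - z) / σ) - (phiPdf ((c - z) / σ) / phiPdf (z / σ)) * Phi (-z / σ)) := by
  refine ⟨fun z => (hasDerivAt_one_sub_Phi_ratio c δ z).differentiableAt, fun z => ?_⟩
  have hpdf := (phiPdf_pos (z / σ)).ne'
  have hPhi := (Phi_pos (-z / σ)).ne'
  rw [(hasDerivAt_one_sub_Phi_ratio c δ z).deriv, div_eq_zero_iff,
    or_iff_left (mul_ne_zero hσ.ne' (pow_ne_zero 2 hPhi)), sub_eq_zero, ← eq_div_iff hpdf,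
    mul_div_right_comm, sub_eq_iff_eq_add, eq_sub_iff_add_eq, add_comm, eq_comm]
end
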